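/- Let p ≥ 1 and d ≥ 1 be integers, let β_max ≥ 0 satisfy d·β_max < 1, let σ_max > 0, let N ≥ 1, and let δ ∈ (0,1). Set ε_max = σ_max·√(2·log(4N/δ)). Let B be a real p × p matrix each of whose rows has at most d nonzero entries, with all entries bounded in absolute value by β_max. Let I : {1,…,N} → {1,…,p} be any update schedule, let ε^{(1)}, …, ε^{(N)} be real random variables on a common probability space (not necessarily independent) such that each ε^{(n)} is centered Gaussian with variance at most σ_max², and define random vectors X^{(0)}, …, X^{(N)} in ℝ^p by: X^{(0)} is a fixed vector with max_i |X_i^{(0)}| ≤ ε_max, and for n ≥ 1, X^{(n)}_{I(n)} = Σ_{j=1}^{p} B_{I(n) j} · X^{(n−1)}_j + ε^{(n)} while X^{(n)}_k = X^{(n−1)}_k for k ≠ I(n). Then P(max_{0≤n≤N} max_{1≤i≤p} |X^{(n)}_i| ≤ ε_max/(1 − d·β_max)) ≥ 1 − δ/2. -/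

import Mathlib

open MeasureTheory ProbabilityTheory

/-- A centered Gaussian variable is sub-Gaussian for every upper bound on its variance. -/
lemma hasSubgaussianMGF_of_map_eq_gaussianReal {Ω : Type*} [MeasurableSpace Ω] {P : Measure Ω}
    {Y : Ω → ℝ} {v c : NNReal} (hY : P.map Y = gaussianReal 0 v) (hvc : v ≤ c) :
    HasSubgaussianMGF Y c P := by
  have hY_meas : AEMeasurable Y P := aemeasurable_of_map_neZero (by rw [hY]; infer_instance)
  refine HasSubgaussianMGF.of_map hY_meas (X := id) ?_
  rw [hY]
  refine ⟨fun t ↦ integrable_exp_mul_gaussianReal t, fun t ↦ ?_⟩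
  simp only [mgf_id_gaussianReal, zero_mul, zero_add]
  gcongr

/-- Two-sided Chernoff bound for a sub-Gaussian variable. -/
lemma ProbabilityTheory.HasSubgaussianMGF.measureReal_lt_abs_le {Ω : Type*} [MeasurableSpace Ω]
    {P : Measure Ω} [IsFiniteMeasure P] {Y : Ω → ℝ} {c : NNReal} (hY : HasSubgaussianMGF Y c P)
    {r : ℝ} (hr : 0 ≤ r) :
    P.real {ω | r < |Y ω|} ≤ 2 * Real.exp (-r ^ 2 / (2 * c)) := by
  calc P.real {ω | r < |Y ω|}
      ≤ P.real ({ω | r ≤ Y ω} ∪ {ω | r ≤ (-Y) ω}) :=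
        measureReal_mono fun ω hω ↦ (lt_abs.1 hω).imp (fun h ↦ h.le) fun h ↦ show r ≤ -Y ω from h.le
    _ ≤ P.real {ω | r ≤ Y ω} + P.real {ω | r ≤ (-Y) ω} := measureReal_union_le _ _
    _ ≤ 2 * Real.exp (-r ^ 2 / (2 * c)) := by
        linarith [hY.measure_ge_le hr, hY.neg.measure_ge_le hr]

/-- A sparse linear form with bounded coefficients, evaluated at a bounded vector. -/
lemma abs_sum_mul_le_of_card_support_le {ι : Type*} [Fintype ι] {b x : ι → ℝ} {d : ℕ} {β M : ℝ}
    (hβ : 0 ≤ β) (hM : 0 ≤ M) (hcard : (Finset.univ.filter fun j => b j ≠ 0).card ≤ d)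
    (hb : ∀ j, |b j| ≤ β) (hx : ∀ j, |x j| ≤ M) :
    |∑ j, b j * x j| ≤ d * β * M := by
  have hsupp : ∑ j, b j * x j = ∑ j ∈ Finset.univ.filter (fun j => b j ≠ 0), b j * x j :=
    (Finset.sum_filter_of_ne fun j _ h ↦ left_ne_zero_of_mul h).symm
  calc |∑ j, b j * x j|
      ≤ ∑ j ∈ Finset.univ.filter (fun j => b j ≠ 0), |b j * x j| :=
        hsupp ▸ Finset.abs_sum_le_sum_abs _ _
    _ ≤ (Finset.univ.filter fun j => b j ≠ 0).card • (β * M) :=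
        Finset.sum_le_card_nsmul _ _ _ fun j _ ↦ by
          rw [abs_mul]
          exact mul_le_mul (hb j) (hx j) (abs_nonneg _) hβ
    _ ≤ d * β * M := by
        rw [nsmul_eq_mul, mul_assoc]
        gcongr

/-- Single-site updates of a contracting sparse linear system with noise at most `r`
stay bounded by `r / (1 - d * β)`. -/
lemma abs_update_le_div_one_sub {ι : Type*} [Fintype ι] {d N : ℕ} {β r : ℝ} (hβ : 0 ≤ β)
    (hcontract : d * β < 1) (hr : 0 ≤ r) {B : Matrix ι ι ℝ}
    (hsparse : ∀ i, (Finset.univ.filter fun j => B i j ≠ 0).card ≤ d)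
    (hentries : ∀ i j, |B i j| ≤ β) {I : ℕ → ι} {e : ℕ → ℝ} {x : ℕ → ι → ℝ}
    (he : ∀ n, 1 ≤ n → n ≤ N → |e n| ≤ r) (hx0 : ∀ i, |x 0 i| ≤ r)
    (hupd : ∀ n, 1 ≤ n → n ≤ N → x n (I n) = (∑ j, B (I n) j * x (n - 1) j) + e n ∧
      ∀ k ≠ I n, x n k = x (n - 1) k) :
    ∀ n ≤ N, ∀ i, |x n i| ≤ r / (1 - d * β) := by
  have hgap : 0 < 1 - d * β := sub_pos.2 hcontract
  have hM : 0 ≤ r / (1 - d * β) := by positivity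
  intro n
  induction n with
  | zero =>
    intro _ i
    refine (hx0 i).trans (le_div_self hr hgap ?_)
    linarith [show 0 ≤ d * β by positivity]
  | succ n ih =>
    intro hn i
    obtain ⟨hsite, hother⟩ := hupd (n + 1) n.succ_pos hn
    rw [Nat.add_sub_cancel] at hsite hother
    have hprev := ih (Nat.le_of_succ_le hn)
    rcases eq_or_ne i (I (n + 1)) with rfl | hi
    · calc |x (n + 1) (I (n + 1))|
          ≤ |∑ j, B (I (n + 1)) j * x n j| + |e (n + 1)| := hsite ▸ abs_add_le _ _
        _ ≤ d * β * (r / (1 - d * β)) + r :=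
            add_le_add (abs_sum_mul_le_of_card_support_le hβ hM (hsparse _) (hentries _) hprev)
              (he _ n.succ_pos hn)
        _ = r / (1 - d * β) := by
            field_simp
            ring
    · rw [hother i hi]
      exact hprev i

/-- **Lemma 4 (high-probability event `C`), discrete-time form.**
For the single-site update chain of a Gaussian graphical model with partial regression
coefficient matrix `B` (at most `d` nonzero entries per row, entries bounded by `βmax`,
`d βmax < 1`), driven by any update schedule `I` and centered Gaussian innovations with
variances at most `σmax²`, all `N` updated states remain bounded by `εmax / (1 - d βmax)`
with probability at least `1 - δ/2`, where `εmax = σmax √(2 log(4N/δ))`. -/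
theorem glauber_states_bounded_whp {Ω : Type*} [MeasurableSpace Ω] (P : Measure Ω)
    [IsProbabilityMeasure P] (p d : ℕ) (hp : 1 ≤ p) (hd : 1 ≤ d)
    (βmax σmax : ℝ) (hβ : 0 ≤ βmax) (hcontract : (d : ℝ) * βmax < 1) (hσ : 0 < σmax)
    (N : ℕ) (hN : 1 ≤ N) (δ : ℝ) (hδ : δ ∈ Set.Ioo (0 : ℝ) 1)
    (εmax : ℝ) (hεmax : εmax = σmax * Real.sqrt (2 * Real.log (4 * N / δ)))
    (B : Matrix (Fin p) (Fin p) ℝ)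
    (hsparse : ∀ i, (Finset.univ.filter fun j => B i j ≠ 0).card ≤ d)
    (hentries : ∀ i j, |B i j| ≤ βmax)
    (I : ℕ → Fin p)
    (e : ℕ → Ω → ℝ)
    (hlaw : ∀ n : ℕ, 1 ≤ n → n ≤ N → ∃ v : NNReal, (v : ℝ) ≤ σmax ^ 2 ∧
      Measure.map (e n) P = gaussianReal 0 v)
    (X : ℕ → Ω → Fin p → ℝ)
    (x0 : Fin p → ℝ) (hx0 : ∀ i, |x0 i| ≤ εmax)
    (hX0 : ∀ ω, X 0 ω = x0)
    (hupd : ∀ n : ℕ, 1 ≤ n → n ≤ N → ∀ ω,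
      X n ω (I n) = (∑ j, B (I n) j * X (n - 1) ω j) + e n ω ∧
      ∀ k ≠ I n, X n ω k = X (n - 1) ω k) :
    ENNReal.ofReal (1 - δ / 2) ≤
      P {ω | ∀ n ≤ N, ∀ i, |X n ω i| ≤ εmax / (1 - (d : ℝ) * βmax)} := by
  have hN0 : (0 : ℝ) < N := by exact_mod_cast hN
  have hδ0 : 0 < δ := hδ.1
  have hratio : 1 ≤ 4 * N / δ := by
    rw [le_div_iff₀ hδ0]
    linarith [hδ.2, show (1 : ℝ) ≤ N by exact_mod_cast hN]
  have hr : 0 ≤ εmax := hεmax ▸ by positivity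
  have hsq : -εmax ^ 2 / (2 * σmax ^ 2) = -Real.log (4 * N / δ) := by
    rw [hεmax, mul_pow, Real.sq_sqrt (by linarith [Real.log_nonneg hratio])]
    field_simp
  have htail : ∀ n ∈ Finset.Icc 1 N, P.real {ω | εmax < |e n ω|} ≤ δ / (2 * N) := by
    intro n hn
    rw [Finset.mem_Icc] at hn
    obtain ⟨v, hv, hmap⟩ := hlaw n hn.1 hn.2
    have hsub := hasSubgaussianMGF_of_map_eq_gaussianReal hmap (c := .mk (σmax ^ 2) (sq_nonneg _)) hv
    refine (hsub.measureReal_lt_abs_le hr).trans_eq ?_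
    rw [NNReal.coe_mk, hsq, Real.exp_neg, Real.exp_log (by linarith)]
    field_simp
    norm_num
  set bad : Set Ω := ⋃ n ∈ Finset.Icc 1 N, {ω | εmax < |e n ω|}
  set good : Set Ω := {ω | ∀ n ≤ N, ∀ i, |X n ω i| ≤ εmax / (1 - (d : ℝ) * βmax)}
  have hbad : P.real bad ≤ δ / 2 :=
    calc P.real bad ≤ ∑ n ∈ Finset.Icc 1 N, P.real {ω | εmax < |e n ω|} :=
          measureReal_biUnion_finset_le _ _
      _ ≤ (Finset.Icc 1 N).card • (δ / (2 * N)) := Finset.sum_le_card_nsmul _ _ _ htail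
      _ = δ / 2 := by
          rw [Nat.card_Icc, Nat.add_sub_cancel, nsmul_eq_mul]
          field_simp
  have hcover : (Set.univ : Set Ω) ⊆ good ∪ bad := by
    intro ω _
    by_cases hω : ω ∈ bad
    · exact Or.inr hω
    · refine Or.inl (abs_update_le_div_one_sub (x := fun n ↦ X n ω) hβ hcontract hr hsparse hentries
        (fun n h1 hn ↦ ?_) (fun i ↦ by simpa only [hX0] using hx0 i) fun n h1 hn ↦ hupd n h1 hn ω)
      by_contra! h
      exact hω (Set.mem_biUnion (Finset.mem_Icc.2 ⟨h1, hn⟩) h)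
  refine ENNReal.ofReal_le_of_le_toReal (?_ : 1 - δ / 2 ≤ P.real good)
  have hone : 1 ≤ P.real (good ∪ bad) := probReal_univ (μ := P) ▸ measureReal_mono hcover
  linarith [measureReal_union_le (μ := P) good bad]
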